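/- arXiv:2406.13628 — 5 statements merged into one kernel-verified Lean document; each statement's English description precedes it below -/
import Mathlib

section
/- Let 0 < r₀ < π/2 and let φ : ℝ → ℝ be continuously differentiable on the closed interval [-r₀, r₀] with φ(-r₀) = φ(r₀) = 0. Set w(r) = √(cos r)·φ(r). Then ∫_{-r₀}^{r₀} φ'(r)²·cos(r) dr = ∫_{-r₀}^{r₀} w'(r)² dr - ∫_{-r₀}^{r₀} (1/2 + (1/4)·tan²(r))·w(r)² dr, and ∫_{-r₀}^{r₀} φ(r)²·cos(r) dr = ∫_{-r₀}^{r₀} w(r)² dr. -/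
open Real Set intervalIntegral

/-- For `0 < r₀ < π/2` and `φ` continuously differentiable on `[-r₀, r₀]` with
`φ(-r₀) = φ(r₀) = 0`, setting `w r = √(cos r) · φ r`, the weighted Dirichlet energy and
weighted L² norm of `φ` transform as
`∫ φ'² cos = ∫ w'² - ∫ (1/2 + (1/4) tan² r) w²` and `∫ φ² cos = ∫ w²`. -/
theorem weighted_rayleigh_substitution (r₀ : ℝ) (hr₀ : 0 < r₀) (hr₀' : r₀ < π / 2)
    (φ φ' : ℝ → ℝ)
    (hφ : ∀ r ∈ Icc (-r₀) r₀, HasDerivAt φ (φ' r) r)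
    (hφ' : ContinuousOn φ' (Icc (-r₀) r₀))
    (hbdry₁ : φ (-r₀) = 0) (hbdry₂ : φ r₀ = 0) :
    (∫ r in (-r₀)..r₀, (φ' r) ^ 2 * Real.cos r) =
      (∫ r in (-r₀)..r₀, (deriv (fun s : ℝ => Real.sqrt (Real.cos s) * φ s) r) ^ 2) -
      ∫ r in (-r₀)..r₀,
        (1 / 2 + (1 / 4) * Real.tan r ^ 2) * (Real.sqrt (Real.cos r) * φ r) ^ 2 ∧
    (∫ r in (-r₀)..r₀, (φ r) ^ 2 * Real.cos r) =
      ∫ r in (-r₀)..r₀, (Real.sqrt (Real.cos r) * φ r) ^ 2 := by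
  have huIcc : uIcc (-r₀) r₀ = Icc (-r₀) r₀ := uIcc_of_le (by linarith)
  have hcos : ∀ r ∈ Icc (-r₀) r₀, 0 < Real.cos r := fun r hr =>
    Real.cos_pos_of_mem_Ioo ⟨by linarith [hr.1], by linarith [hr.2]⟩
  have hφc : ContinuousOn φ (Icc (-r₀) r₀) := fun r hr =>
    (hφ r hr).continuousAt.continuousWithinAt
  have hsc : ContinuousOn Real.sin (Icc (-r₀) r₀) := Real.continuous_sin.continuousOn
  have hcc : ContinuousOn Real.cos (Icc (-r₀) r₀) := Real.continuous_cos.continuousOn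
  have henergy : ∀ r ∈ uIcc (-r₀) r₀,
      (deriv (fun s : ℝ => Real.sqrt (Real.cos s) * φ s) r) ^ 2 =
        (φ' r) ^ 2 * Real.cos r - Real.sin r * φ r * φ' r
          + Real.sin r ^ 2 / (4 * Real.cos r) * φ r ^ 2 := by
    intro r hr
    rw [huIcc] at hr
    have hc := hcos r hr
    have hs := Real.sqrt_pos.2 hc
    have hsq := Real.sq_sqrt hc.le
    rw [(((Real.hasDerivAt_cos r).sqrt hc.ne').fun_mul (hφ r hr)).deriv]
    have hinv : Real.sqrt (Real.cos r) * (Real.sqrt (Real.cos r))⁻¹ = 1 :=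
      mul_inv_cancel₀ hs.ne'
    calc _ = (φ' r) ^ 2 * Real.sqrt (Real.cos r) ^ 2 - Real.sin r * φ r * φ' r
          + Real.sin r ^ 2 / (4 * Real.sqrt (Real.cos r) ^ 2) * φ r ^ 2 := by
            field_simp
            ring
      _ = _ := by rw [hsq]
  have hpotential : ∀ r ∈ uIcc (-r₀) r₀,
      (1 / 2 + (1 / 4) * Real.tan r ^ 2) * (Real.sqrt (Real.cos r) * φ r) ^ 2 =
        Real.cos r / 2 * φ r ^ 2 + Real.sin r ^ 2 / (4 * Real.cos r) * φ r ^ 2 := by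
    intro r hr
    rw [huIcc] at hr
    have hc := hcos r hr
    rw [mul_pow, Real.sq_sqrt hc.le, Real.tan_eq_sin_div_cos]
    field_simp
  have hdiv : ContinuousOn (fun r => Real.sin r ^ 2 / (4 * Real.cos r)) (Icc (-r₀) r₀) :=
    (hsc.pow 2).div (continuousOn_const.mul hcc)
      fun r hr => (mul_pos four_pos (hcos r hr)).ne'
  have hboundary : ∫ r in (-r₀)..r₀,
      (Real.cos r * (φ r ^ 2 / 2) + Real.sin r * (φ r * φ' r)) = 0 := by
    rw [integral_eq_sub_of_hasDerivAt (f := fun r => Real.sin r * (φ r ^ 2 / 2))]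
    · simp [hbdry₁, hbdry₂]
    · intro r hr
      rw [huIcc] at hr
      refine ((Real.hasDerivAt_sin r).fun_mul
        (((hφ r hr).fun_pow 2).div_const 2)).congr_deriv ?_
      push_cast
      ring
    · refine ContinuousOn.intervalIntegrable ?_
      rw [huIcc]
      fun_prop
  constructor
  · rw [integral_congr henergy, integral_congr hpotential, ← integral_sub, ← sub_eq_zero,
      ← integral_sub, ← hboundary]
    · exact integral_congr fun r _ => by ring
    all_goals
      refine ContinuousOn.intervalIntegrable ?_
      rw [huIcc]
      fun_prop
  · refine integral_congr fun r hr => ?_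
    rw [huIcc] at hr
    simp only [mul_pow, Real.sq_sqrt (hcos r hr).le, mul_comm]
end

section
/- For every real number r₀ with 0 < r₀ < π/3, one has (π/(2r₀))² - 1/2 - (1/4)·tan²(r₀) > 1. -/
open Real

/-- For every `0 < r₀ < π/3`, one has `(π/(2r₀))² - 1/2 - (1/4)·tan² r₀ > 1`. -/
theorem poincare_potential_bound (r₀ : ℝ) (hr₀ : 0 < r₀) (hr₀' : r₀ < π / 3) :
    (π / (2 * r₀)) ^ 2 - 1 / 2 - (1 / 4) * Real.tan r₀ ^ 2 > 1 := by
  have poincare_lower : 3 / 2 < π / (2 * r₀) := by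
    rw [lt_div_iff₀ (by positivity)]
    linarith
  have tan_lt : tan r₀ < √3 := by
    rw [← tan_pi_div_three]
    exact tan_lt_tan_of_nonneg_of_lt_pi_div_two hr₀.le (by linarith [pi_pos]) hr₀'
  have tan_pos : 0 < tan r₀ := tan_pos_of_pos_of_lt_pi_div_two hr₀ (by linarith [pi_pos])
  have tan_sq_lt : tan r₀ ^ 2 < 3 := (lt_sqrt tan_pos.le).mp tan_lt
  nlinarith
end

section
/- Let 0 < r₀ < π/3 and let φ : ℝ → ℝ be continuously differentiable on the closed interval [-r₀, r₀] with φ(-r₀) = φ(r₀) = 0, and suppose φ is not identically zero on [-r₀, r₀]. Then ∫_{-r₀}^{r₀} φ'(r)²·cos(r) dr > ∫_{-r₀}^{r₀} φ(r)²·cos(r) dr. -/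
open Real Set intervalIntegral

/-- The weight `-cos r * deriv u r / u r` for the positive supersolution
`u r = cos (3 * r / 2) / √(cos r)`. -/
noncomputable def riccatiWeight (r : ℝ) : ℝ :=
  3 / 2 * Real.tan (3 / 2 * r) * Real.cos r - Real.sin r / 2

/-- The derivative of `riccatiWeight` on `(-π/3, π/3)`. -/
noncomputable def riccatiWeightDeriv (r : ℝ) : ℝ :=
  (9 / 4 * (1 + Real.tan (3 / 2 * r) ^ 2) - 1 / 2) * Real.cos r
    - 3 / 2 * Real.tan (3 / 2 * r) * Real.sin r

lemma cos_three_halves_mul_pos {r : ℝ} (h : |r| < π / 3) : 0 < Real.cos (3 / 2 * r) := by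
  rw [abs_lt] at h
  exact Real.cos_pos_of_mem_Ioo ⟨by linarith [h.1], by linarith [h.2]⟩

lemma half_lt_cos {r : ℝ} (h : |r| < π / 3) : 1 / 2 < Real.cos r := by
  rw [← Real.cos_abs, ← Real.cos_pi_div_three]
  exact Real.cos_lt_cos_of_nonneg_of_le_pi (abs_nonneg r) (by linarith [Real.pi_pos]) h

lemma hasDerivAt_riccatiWeight {r : ℝ} (h : |r| < π / 3) :
    HasDerivAt riccatiWeight (riccatiWeightDeriv r) r := by
  have hc := (cos_three_halves_mul_pos h).ne'
  have h₁ := (Real.hasDerivAt_tan hc).comp r ((hasDerivAt_id r).const_mul (3 / 2))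
  refine (((h₁.const_mul (3 / 2)).mul (Real.hasDerivAt_cos r)).sub
    ((Real.hasDerivAt_sin r).div_const 2)).congr_deriv ?_
  have h₂ : 1 / Real.cos (3 / 2 * r) ^ 2 = 1 + Real.tan (3 / 2 * r) ^ 2 := by
    rw [← Real.inv_one_add_tan_sq hc, one_div, inv_inv]
  simp only [Function.comp_apply, h₂, riccatiWeightDeriv]
  ring

lemma continuousOn_riccatiWeightDeriv {s : Set ℝ} (hs : ∀ r ∈ s, |r| < π / 3) :
    ContinuousOn riccatiWeightDeriv s := by
  have ht : ContinuousOn (fun r : ℝ => Real.tan (3 / 2 * r)) s := fun r hr =>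
    ((Real.continuousAt_tan.2 (cos_three_halves_mul_pos (hs r hr)).ne').comp
      (f := fun r : ℝ => 3 / 2 * r) (by fun_prop)).continuousWithinAt
  unfold riccatiWeightDeriv
  fun_prop

/-- Completing the square in the weighted energy density. -/
lemma cos_mul_energy_add_deriv (r a b : ℝ) :
    Real.cos r * (b ^ 2 * Real.cos r - (a ^ 2 * Real.cos r
        - (2 * a * b * riccatiWeight r + a ^ 2 * riccatiWeightDeriv r))) =
      (b * Real.cos r + a * riccatiWeight r) ^ 2 + a ^ 2 * (Real.cos r ^ 2 - 1 / 4) := by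
  have h := Real.sin_sq_add_cos_sq r
  unfold riccatiWeight riccatiWeightDeriv
  linear_combination (-(a ^ 2) / 4) * h

/-- For `0 < r₀ < π/3` and `φ` continuously differentiable on `[-r₀, r₀]` with
`φ(-r₀) = φ(r₀) = 0` and not identically zero on `[-r₀, r₀]`, the weighted Rayleigh
quotient is strictly greater than `1`: `∫ φ'² cos r dr > ∫ φ² cos r dr`. -/
theorem weighted_rayleigh_gt_one (r₀ : ℝ) (hr₀ : 0 < r₀) (hr₀' : r₀ < π / 3)
    (φ φ' : ℝ → ℝ)
    (hφ : ∀ r ∈ Icc (-r₀) r₀, HasDerivAt φ (φ' r) r)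
    (hφ' : ContinuousOn φ' (Icc (-r₀) r₀))
    (hbdry₁ : φ (-r₀) = 0) (hbdry₂ : φ r₀ = 0)
    (hne : ∃ r ∈ Icc (-r₀) r₀, φ r ≠ 0) :
    (∫ r in (-r₀)..r₀, (φ' r) ^ 2 * Real.cos r) >
      ∫ r in (-r₀)..r₀, (φ r) ^ 2 * Real.cos r := by
  have habs : ∀ r ∈ Icc (-r₀) r₀, |r| < π / 3 := fun r hr => (abs_le.2 hr).trans_lt hr₀'
  have hcos : ∀ r ∈ Icc (-r₀) r₀, 1 / 2 < Real.cos r := fun r hr => half_lt_cos (habs r hr)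
  have hle : -r₀ ≤ r₀ := by linarith
  have hcφ : ContinuousOn φ (Icc (-r₀) r₀) := fun r hr =>
    (hφ r hr).continuousAt.continuousWithinAt
  have hcw : ContinuousOn riccatiWeight (Icc (-r₀) r₀) := fun r hr =>
    (hasDerivAt_riccatiWeight (habs r hr)).continuousAt.continuousWithinAt
  have hcw' := continuousOn_riccatiWeightDeriv habs
  have hcF : ContinuousOn (fun r => 2 * φ r * φ' r * riccatiWeight r
      + φ r ^ 2 * riccatiWeightDeriv r) (Icc (-r₀) r₀) := by fun_prop
  have hcE : ContinuousOn (fun r => φ r ^ 2 * Real.cos r) (Icc (-r₀) r₀) := by fun_prop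
  have hF : ∫ r in (-r₀)..r₀, (2 * φ r * φ' r * riccatiWeight r
      + φ r ^ 2 * riccatiWeightDeriv r) = 0 := by
    rw [integral_eq_sub_of_hasDerivAt (f := fun r => φ r ^ 2 * riccatiWeight r)]
    · simp [hbdry₁, hbdry₂]
    · intro r hr
      rw [uIcc_of_le hle] at hr
      refine (((hφ r hr).pow 2).mul (hasDerivAt_riccatiWeight (habs r hr))).congr_deriv ?_
      simp
    · exact hcF.intervalIntegrable_of_Icc hle
  have hsub : ∫ r in (-r₀)..r₀, φ r ^ 2 * Real.cos r =
      ∫ r in (-r₀)..r₀, (φ r ^ 2 * Real.cos r - (2 * φ r * φ' r * riccatiWeight r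
        + φ r ^ 2 * riccatiWeightDeriv r)) := by
    rw [integral_sub (hcE.intervalIntegrable_of_Icc hle)
      (hcF.intervalIntegrable_of_Icc hle), hF, sub_zero]
  rw [gt_iff_lt, hsub]
  refine integral_lt_integral_of_continuousOn_of_le_of_exists_lt (by linarith)
    (hcE.sub hcF) (by fun_prop) (fun r hr => ?_) ?_
  · have hc := hcos r (Ioc_subset_Icc_self hr)
    refine sub_nonneg.1 (nonneg_of_mul_nonneg_right ?_ (by linarith : 0 < Real.cos r))
    rw [cos_mul_energy_add_deriv]
    have : 0 ≤ Real.cos r ^ 2 - 1 / 4 := by nlinarith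
    positivity
  · obtain ⟨r, hr, hne⟩ := hne
    have hc := hcos r hr
    refine ⟨r, hr, sub_pos.1 (pos_of_mul_pos_right ?_ (by linarith : 0 ≤ Real.cos r))⟩
    rw [cos_mul_energy_add_deriv]
    have : 0 < Real.cos r ^ 2 - 1 / 4 := by nlinarith
    positivity
end

section
/- Let 0 < r₀ < π/3, let λ be a real number, and let φ : ℝ → ℝ be twice continuously differentiable on the closed interval [-r₀, r₀] with φ(-r₀) = φ(r₀) = 0, not identically zero on [-r₀, r₀], and satisfying φ''(r) - tan(r)·φ'(r) + λ·φ(r) = 0 for all r in [-r₀, r₀]. Then λ > 1. -/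
open Real Set

lemma half_lt_cos_of_abs_lt_pi_div_three {r : ℝ} (hr : |r| < π / 3) : 1 / 2 < Real.cos r := by
  rw [← Real.cos_abs r, ← Real.cos_pi_div_three]
  exact Real.cos_lt_cos_of_nonneg_of_le_pi (abs_nonneg r) (by linarith [Real.pi_pos]) hr

lemma hasDerivAt_tan_one_add_sq {r : ℝ} (hc : Real.cos r ≠ 0) :
    HasDerivAt Real.tan (1 + Real.tan r ^ 2) r := by
  convert Real.hasDerivAt_tan hc using 1
  rw [← Real.inv_one_add_tan_sq hc, one_div, inv_inv]

/-- The logarithmic derivative of the positive supersolution `cos (3r/2) / √(cos r)`. -/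
noncomputable def supersolutionLogDeriv (r : ℝ) : ℝ :=
  Real.tan r / 2 - 3 / 2 * Real.tan (3 / 2 * r)

lemma hasDerivAt_supersolutionLogDeriv {r : ℝ} (hr : |r| < π / 3) :
    HasDerivAt supersolutionLogDeriv
      (Real.tan r * supersolutionLogDeriv r - supersolutionLogDeriv r ^ 2
        - (7 - Real.tan r ^ 2) / 4) r := by
  have hc : Real.cos r ≠ 0 := by linarith [half_lt_cos_of_abs_lt_pi_div_three hr]
  have hC : Real.cos (3 / 2 * r) ≠ 0 := by
    rw [abs_lt] at hr
    exact (Real.cos_pos_of_mem_Ioo ⟨by linarith, by linarith⟩).ne'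
  have h₁ := (hasDerivAt_tan_one_add_sq hc).div_const 2
  have h₂ := ((hasDerivAt_tan_one_add_sq hC).comp r
    ((hasDerivAt_id r).const_mul (3 / 2 : ℝ))).const_mul (3 / 2 : ℝ)
  refine (h₁.sub h₂).congr_deriv ?_
  simp only [supersolutionLogDeriv]
  ring

/-- Picone's identity for the radial equation against the supersolution. -/
lemma hasDerivAt_picone {r lam : ℝ} {φ φ' φ'' : ℝ → ℝ} (hr : |r| < π / 3)
    (hφ : HasDerivAt φ (φ' r) r) (hφ' : HasDerivAt φ' (φ'' r) r)
    (hode : φ'' r - Real.tan r * φ' r + lam * φ r = 0) :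
    HasDerivAt (fun x => Real.cos x * (φ x * φ' x - φ x ^ 2 * supersolutionLogDeriv x))
      (Real.cos r * ((φ' r - supersolutionLogDeriv r * φ r) ^ 2
        + φ r ^ 2 * ((7 - Real.tan r ^ 2) / 4 - lam))) r := by
  have hc : Real.cos r ≠ 0 := by linarith [half_lt_cos_of_abs_lt_pi_div_three hr]
  have hs : Real.sin r = Real.tan r * Real.cos r := (Real.tan_mul_cos hc).symm
  have hφ₂ : φ'' r = Real.tan r * φ' r - lam * φ r := by linarith
  have h := (Real.hasDerivAt_cos r).mul
    ((hφ.mul hφ').sub ((hφ.pow 2).mul (hasDerivAt_supersolutionLogDeriv hr)))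
  refine h.congr_deriv ?_
  simp only [Pi.mul_apply, Pi.sub_apply, Pi.pow_apply]
  rw [hφ₂, hs]
  push_cast
  ring

lemma tan_sq_lt_three_of_abs_lt_pi_div_three {r : ℝ} (hr : |r| < π / 3) :
    Real.tan r ^ 2 < 3 := by
  have hc := half_lt_cos_of_abs_lt_pi_div_three hr
  rw [Real.tan_eq_sin_div_cos, div_pow, div_lt_iff₀ (by positivity)]
  nlinarith [Real.sin_sq_add_cos_sq r]

/-- Every radial Dirichlet eigenvalue of the annulus `A_{r₀}` in the round 2-sphere
exceeds `1` when `0 < r₀ < π/3`: if `φ` is twice continuously differentiable on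
`[-r₀, r₀]`, vanishes at `±r₀`, is not identically zero, and satisfies
`φ'' - tan r · φ' + λ φ = 0` on `[-r₀, r₀]`, then `λ > 1`. -/
theorem radial_eigenvalue_gt_one (r₀ : ℝ) (hr₀ : 0 < r₀) (hr₀' : r₀ < π / 3)
    (lam : ℝ) (φ φ' φ'' : ℝ → ℝ)
    (hφ : ∀ r ∈ Icc (-r₀) r₀, HasDerivAt φ (φ' r) r)
    (hφ' : ∀ r ∈ Icc (-r₀) r₀, HasDerivAt φ' (φ'' r) r)
    (hφ'' : ContinuousOn φ'' (Icc (-r₀) r₀))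
    (hbdry₁ : φ (-r₀) = 0) (hbdry₂ : φ r₀ = 0)
    (hne : ∃ r ∈ Icc (-r₀) r₀, φ r ≠ 0)
    (hode : ∀ r ∈ Icc (-r₀) r₀, φ'' r - Real.tan r * φ' r + lam * φ r = 0) :
    lam > 1 := by
  by_contra! hlam
  have habs : ∀ r ∈ Icc (-r₀) r₀, |r| < π / 3 := fun r hr =>
    (abs_le.2 hr).trans_lt hr₀'
  set F : ℝ → ℝ := fun x => Real.cos x * (φ x * φ' x - φ x ^ 2 * supersolutionLogDeriv x)
    with hF
  have hderiv := fun r hr =>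
    hasDerivAt_picone (habs r hr) (hφ r hr) (hφ' r hr) (hode r hr)
  have hcos : ∀ r ∈ Icc (-r₀) r₀, 0 < Real.cos r := fun r hr => by
    linarith [half_lt_cos_of_abs_lt_pi_div_three (habs r hr)]
  have hgap : ∀ r ∈ Icc (-r₀) r₀, 0 < (7 - Real.tan r ^ 2) / 4 - lam := fun r hr => by
    linarith [tan_sq_lt_three_of_abs_lt_pi_div_three (habs r hr)]
  have hmono : MonotoneOn F (Icc (-r₀) r₀) := by
    refine monotoneOn_of_deriv_nonneg (convex_Icc _ _)
      (fun r hr => (hderiv r hr).continuousAt.continuousWithinAt)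
      (fun r hr => (hderiv r (interior_subset hr)).differentiableAt.differentiableWithinAt)
      fun r hr => ?_
    have hr' := interior_subset hr
    have := hcos r hr'
    have := hgap r hr'
    rw [(hderiv r hr').deriv]
    positivity
  have hzero : ∀ r ∈ Icc (-r₀) r₀, F r = 0 := by
    intro r hr
    have h₁ := hmono (left_mem_Icc.2 (by linarith)) hr hr.1
    have h₂ := hmono hr (right_mem_Icc.2 (by linarith)) hr.2
    simp only [hF, hbdry₁, hbdry₂] at h₁ h₂ ⊢
    apply le_antisymm <;> linarith
  obtain ⟨r, hr, hφr⟩ := hne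
  have hl : -r₀ < r := lt_of_le_of_ne hr.1 fun h => hφr (h ▸ hbdry₁)
  have hu : r < r₀ := lt_of_le_of_ne hr.2 fun h => hφr (h ▸ hbdry₂)
  have hF₀ : HasDerivAt F 0 r := (hasDerivAt_const r (0 : ℝ)).congr_of_eventuallyEq <|
    Filter.eventually_of_mem (Icc_mem_nhds hl hu) hzero
  have hpos : 0 < Real.cos r * ((φ' r - supersolutionLogDeriv r * φ r) ^ 2
      + φ r ^ 2 * ((7 - Real.tan r ^ 2) / 4 - lam)) := by
    have := hcos r hr
    have := hgap r hr
    positivity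
  exact hpos.ne (hF₀.unique (hderiv r hr))
end

section
/- Let r₀ > 0, let q : ℝ → ℝ be continuous on [-r₀, r₀], and let Q be a real number with q(r) ≥ Q for all r in [-r₀, r₀]. Let λ be a real number and let w : ℝ → ℝ be twice continuously differentiable on [-r₀, r₀], not identically zero, with w(-r₀) = w(r₀) = 0 and satisfying w''(r) - q(r)·w(r) + λ·w(r) = 0 for all r in [-r₀, r₀]. Then λ ≥ (π/(2r₀))² + Q. -/
open Real Set

/-- A function that is positive somewhere on `[-a, a]`, vanishes at `±a`, and satisfies
`u'' + μ u ≥ 0` wherever it is positive has `μ ≥ (π / (2a))²`. -/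
theorem sq_pi_div_le_of_subsolution {a μ : ℝ} (ha : 0 < a) {u u' u'' : ℝ → ℝ}
    (hu : ∀ r ∈ Icc (-a) a, HasDerivAt u (u' r) r)
    (hu' : ∀ r ∈ Icc (-a) a, HasDerivAt u' (u'' r) r)
    (hpos : ∃ r ∈ Icc (-a) a, 0 < u r) (hleft : u (-a) = 0) (hright : u a = 0)
    (hsub : ∀ r ∈ Icc (-a) a, 0 < u r → 0 ≤ u'' r + μ * u r) :
    (π / (2 * a)) ^ 2 ≤ μ := by
  by_contra! hlt
  have hk : 0 < π / (2 * a) := by positivity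
  obtain ⟨s, hs, hsk⟩ : ∃ s, max μ 0 < s ∧ s < (π / (2 * a)) ^ 2 :=
    exists_between (max_lt hlt (by positivity))
  have hs0 : 0 < s := (le_max_right _ _).trans_lt hs
  have hμs : μ < s := (le_max_left _ _).trans_lt hs
  obtain ⟨m, hm0, rfl⟩ : ∃ m, 0 < m ∧ m ^ 2 = s := ⟨√s, Real.sqrt_pos.2 hs0, Real.sq_sqrt hs0.le⟩
  have hmk : m < π / (2 * a) := lt_of_pow_lt_pow_left₀ 2 hk.le hsk
  have hma : m * a < π / 2 := by
    rw [lt_div_iff₀ (by positivity)] at hmk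
    linarith
  have hcos : ∀ r ∈ Icc (-a) a, 0 < cos (m * r) := fun r hr =>
    cos_pos_of_mem_Ioo ⟨by nlinarith [hr.1], by nlinarith [hr.2]⟩
  have hcont : ContinuousOn (fun r => u r / cos (m * r)) (Icc (-a) a) :=
    ContinuousOn.div (fun r hr => (hu r hr).continuousAt.continuousWithinAt)
      (by fun_prop) fun r hr => (hcos r hr).ne'
  obtain ⟨p, hp, hup⟩ := hpos
  obtain ⟨x, hx, hmax⟩ := isCompact_Icc.exists_isMaxOn ⟨p, hp⟩ hcont
  set M := u x / cos (m * x) with hM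
  have hMpos : 0 < M := (div_pos hup (hcos p hp)).trans_le (hmax hp)
  have hux : u x = M * cos (m * x) := by rw [hM, div_mul_cancel₀ _ (hcos x hx).ne']
  have hux_pos : 0 < u x := hux ▸ mul_pos hMpos (hcos x hx)
  have hxl : -a < x := lt_of_le_of_ne hx.1 (by rintro rfl; linarith)
  have hxr : x < a := lt_of_le_of_ne hx.2 (by rintro rfl; linarith)
  have hnhds : Icc (-a) a ∈ nhds x := Icc_mem_nhds hxl hxr
  set v : ℝ → ℝ := fun r => u r - M * cos (m * r)
  have hv' : ∀ r ∈ Icc (-a) a, HasDerivAt v (u' r + M * m * sin (m * r)) r := fun r hr => by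
    have h := (hu r hr).sub ((((hasDerivAt_id r).const_mul m).cos).const_mul M)
    refine h.congr_deriv ?_
    simp only [id]
    ring
  have hdv : deriv v =ᶠ[nhds x] fun r => u' r + M * m * sin (m * r) := by
    filter_upwards [hnhds] with r hr using (hv' r hr).deriv
  have hddv : deriv (deriv v) x = u'' x + m ^ 2 * u x := by
    rw [hdv.deriv_eq]
    have h := (hu' x hx).add ((((hasDerivAt_id x).const_mul m).sin).const_mul (M * m))
    refine h.deriv.trans ?_
    rw [hux]
    simp only [id]
    ring
  have hddv_pos : 0 < deriv (deriv v) x := by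
    rw [hddv]
    nlinarith [hsub x hx hux_pos]
  have hvx : v x = 0 := sub_eq_zero.2 hux
  have hle : ∀ᶠ r in nhds x, v r ≤ 0 := by
    filter_upwards [hnhds] with r hr
    exact sub_nonpos.2 ((div_le_iff₀ (hcos r hr)).1 (hmax hr))
  have hlocmax : IsLocalMax v x := by
    filter_upwards [hle] with r hr using hr.trans_eq hvx.symm
  have hlocmin : IsLocalMin v x :=
    isLocalMin_of_deriv_deriv_pos hddv_pos hlocmax.deriv_eq_zero (hv' x hx).continuousAt
  have hzero : v =ᶠ[nhds x] fun _ => 0 := by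
    filter_upwards [hle, hlocmin] with r h₁ h₂ using le_antisymm h₁ (hvx ▸ h₂)
  have hddv_zero : deriv (deriv v) x = 0 := by
    rw [hzero.deriv.deriv_eq]
    simp
  exact hddv_pos.ne' hddv_zero

/-- Sturm–Liouville lower bound: if `q` is continuous on `[-r₀, r₀]` with `q ≥ Q` there,
and `w` is a nontrivial twice continuously differentiable solution of
`w'' - q·w + λ·w = 0` on `[-r₀, r₀]` with `w(±r₀) = 0`, then `λ ≥ (π/(2r₀))² + Q`. -/
theorem sturm_liouville_lower_bound (r₀ : ℝ) (hr₀ : 0 < r₀) (q : ℝ → ℝ)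
    (hq : ContinuousOn q (Icc (-r₀) r₀)) (Q : ℝ)
    (hqQ : ∀ r ∈ Icc (-r₀) r₀, q r ≥ Q)
    (lam : ℝ) (w w' w'' : ℝ → ℝ)
    (hw : ∀ r ∈ Icc (-r₀) r₀, HasDerivAt w (w' r) r)
    (hw' : ∀ r ∈ Icc (-r₀) r₀, HasDerivAt w' (w'' r) r)
    (hw'' : ContinuousOn w'' (Icc (-r₀) r₀))
    (hne : ∃ r ∈ Icc (-r₀) r₀, w r ≠ 0)
    (hbdry₁ : w (-r₀) = 0) (hbdry₂ : w r₀ = 0)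
    (hode : ∀ r ∈ Icc (-r₀) r₀, w'' r - q r * w r + lam * w r = 0) :
    lam ≥ (π / (2 * r₀)) ^ 2 + Q := by
  have hbound : (π / (2 * r₀)) ^ 2 ≤ lam - Q := by
    obtain ⟨p, hp, hwp⟩ := hne
    rcases hwp.lt_or_gt with hneg | hpos
    · refine sq_pi_div_le_of_subsolution hr₀ (fun r hr => (hw r hr).neg)
        (fun r hr => (hw' r hr).neg) ⟨p, hp, neg_pos.2 hneg⟩ (by simp [hbdry₁])
        (by simp [hbdry₂]) fun r hr h => ?_
      simp only [Pi.neg_apply] at h ⊢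
      nlinarith [hode r hr, mul_nonneg (sub_nonneg.2 (hqQ r hr)) h.le]
    · refine sq_pi_div_le_of_subsolution hr₀ hw hw' ⟨p, hp, hpos⟩ hbdry₁ hbdry₂ fun r hr h => ?_
      nlinarith [hode r hr, mul_nonneg (sub_nonneg.2 (hqQ r hr)) h.le]
  linarith
end
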